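/- Let A₁ and A₂ be N×N real symmetric positive-definite matrices, let V ∈ ℝ^{N×n} have full column rank n, and let S ∈ {0,1}^{N×m} be a sampling matrix with n ≤ m ≤ N (so that SᵀA₁S and SᵀA₂S are symmetric positive definite). Then there exists a matrix Z ∈ ℝ^{m×n} such that Zᵀ Sᵀ (a A₁ + b A₂) S Z = Vᵀ (a A₁ + b A₂) V for all real scalars a, b (equivalently, Zᵀ(SᵀA₁S)Z = VᵀA₁V and Zᵀ(SᵀA₂S)Z = VᵀA₂V simultaneously) if and only if the generalized eigenvalues λ^{(r)}_1 ≤ … ≤ λ^{(r)}_n of the pencil (VᵀA₂V, VᵀA₁V) interlace the generalized eigenvalues λ^{(s)}_1 ≤ … ≤ λ^{(s)}_m of the pencil (SᵀA₂S, SᵀA₁S), i.e., λ^{(s)}_i ≤ λ^{(r)}_i ≤ λ^{(s)}_{i+m−n} for i = 1, …, n. -/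

import Mathlib

open Matrix

/-- The `N × m` sampling matrix whose `j`-th column is the `ι j`-th column of the
`N × N` identity matrix. -/
def samplingMatrix {N m : ℕ} (ι : Fin m → Fin N) : Matrix (Fin N) (Fin m) ℝ :=
  fun i j => if i = ι j then 1 else 0

/-- `lam` is the increasing (with multiplicity) sequence of generalized eigenvalues of
the pencil `(B, D)` with `D` symmetric positive definite and `B` symmetric: there is a
congruence simultaneously taking `D` to the identity and `B` to `diagonal lam`. -/
def IsSortedGenEigs {k : ℕ} (B D : Matrix (Fin k) (Fin k) ℝ) (lam : Fin k → ℝ) : Prop :=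
  Monotone lam ∧
    ∃ X : Matrix (Fin k) (Fin k) ℝ, Xᵀ * D * X = 1 ∧ Xᵀ * B * X = Matrix.diagonal lam

open Finset in
/-- The vector of nodal weights `∏ⱼ (μᵢ - λⱼ) / ∏_{k ≠ i} (μᵢ - μₖ)` is orthogonal to each
`(μᵢ - λⱼ)⁻¹`. -/
lemma sum_prod_div_prod_erase_mul_inv {n : ℕ} {mu : Fin (n + 1) → ℝ} {lam : Fin n → ℝ}
    (hmu : Function.Injective mu) (hne : ∀ i j, mu i - lam j ≠ 0) (j : Fin n) :
    ∑ i, (∏ l, (mu i - lam l)) / (∏ k ∈ univ.erase i, (mu i - mu k)) * (mu i - lam j)⁻¹ = 0 := by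
  classical
  set P : Polynomial ℝ := Lagrange.nodal (univ.erase j) lam with hP
  have hlt : P.degree < (n : ℕ) := by
    rw [hP, Lagrange.degree_nodal, card_erase_of_mem (mem_univ j), card_univ, Fintype.card_fin]
    have := j.2
    exact_mod_cast (by omega : n - 1 < n)
  have hlt' : P.degree < (#(univ : Finset (Fin (n + 1))) : ℕ) := by
    rw [card_univ, Fintype.card_fin]
    exact hlt.trans (by exact_mod_cast Nat.lt_succ_self n)
  have key := Lagrange.coeff_eq_sum (s := univ) (v := mu) hmu.injOn hlt'
  rw [card_univ, Fintype.card_fin, Nat.add_sub_cancel,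
    Polynomial.coeff_eq_zero_of_degree_lt hlt] at key
  rw [key]
  refine sum_congr rfl fun i _ => ?_
  rw [hP, Lagrange.eval_nodal, ← mul_prod_erase univ (fun l => mu i - lam l) (mem_univ j)]
  field_simp [hne i j]

open Finset in
lemma prod_div_prod_erase_pos {n : ℕ} {mu : Fin (n + 1) → ℝ} {lam : Fin n → ℝ}
    (hmu : StrictMono mu) (h₁ : ∀ j, mu j.castSucc < lam j) (h₂ : ∀ j, lam j < mu j.succ)
    (i : Fin (n + 1)) :
    0 < (∏ l, (mu i - lam l)) / (∏ k ∈ univ.erase i, (mu i - mu k)) := by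
  have herase : ∏ k ∈ univ.erase i, (mu i - mu k) = ∏ l, (mu i - mu (i.succAbove l)) := by
    rw [← compl_singleton, ← Fin.image_succAbove_univ,
      prod_image fun _ _ _ _ h => Fin.succAbove_right_injective h]
  rw [herase, ← prod_div_distrib]
  refine prod_pos fun l _ => ?_
  rcases lt_or_ge l.castSucc i with hl | hl
  · rw [Fin.succAbove_of_castSucc_lt _ _ hl]
    have h : mu l.succ ≤ mu i := hmu.monotone (Fin.castSucc_lt_iff_succ_le.1 hl)
    exact div_pos (by linarith [h₂ l]) (by linarith [hmu hl])
  · rw [Fin.succAbove_of_le_castSucc _ _ hl]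
    have h : mu i ≤ mu l.castSucc := hmu.monotone hl
    exact div_pos_of_neg_of_neg (by linarith [h₁ l]) (by linarith [h₁ l, h₂ l])

/-- Converse of Cauchy interlacing in codimension one, strict case. -/
lemma exists_isometry_diagonal_of_strict_interlace {n : ℕ} (mu : Fin (n + 1) → ℝ)
    (lam : Fin n → ℝ) (h₁ : ∀ j, mu j.castSucc < lam j) (h₂ : ∀ j, lam j < mu j.succ) :
    ∃ W : Matrix (Fin (n + 1)) (Fin n) ℝ,
      Wᵀ * W = 1 ∧ Wᵀ * diagonal mu * W = diagonal lam := by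
  have hmu : StrictMono mu := Fin.strictMono_iff_lt_succ.2 fun j => (h₁ j).trans (h₂ j)
  have hne : ∀ i j, mu i - lam j ≠ 0 := by
    intro i j
    rcases lt_or_ge j.castSucc i with hl | hl
    · have h : mu j.succ ≤ mu i := hmu.monotone (Fin.castSucc_lt_iff_succ_le.1 hl)
      exact ne_of_gt (by linarith [h₂ j])
    · have h : mu i ≤ mu j.castSucc := hmu.monotone hl
      exact ne_of_lt (by linarith [h₁ j])
  have hlam : Function.Injective lam := by
    refine StrictMono.injective fun j k hjk => ?_
    have h : mu j.succ ≤ mu k.castSucc := hmu.monotone (Fin.succ_le_castSucc_iff.2 hjk)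
    linarith [h₂ j, h₁ k]
  obtain ⟨w, hw, hsum⟩ : ∃ w : Fin (n + 1) → ℝ, (∀ i, 0 < w i) ∧
      ∀ j, ∑ i, w i * (mu i - lam j)⁻¹ = 0 :=
    ⟨_, prod_div_prod_erase_pos hmu h₁ h₂,
      sum_prod_div_prod_erase_mul_inv hmu.injective hne⟩
  set G : Fin n → Fin n → ℝ :=
    fun j k => ∑ i, w i * (mu i - lam j)⁻¹ * (mu i - lam k)⁻¹ with hG
  have hGoff : ∀ j k, j ≠ k → G j k = 0 := by
    intro j k hjk
    have hsub : lam j - lam k ≠ 0 := sub_ne_zero.2 (hlam.ne hjk)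
    have h : (lam j - lam k) * G j k = 0 := by
      rw [← sub_zero (0 : ℝ)]
      nth_rewrite 1 [← hsum j]
      rw [← hsum k, hG, Finset.mul_sum, ← Finset.sum_sub_distrib]
      refine Finset.sum_congr rfl fun i _ => ?_
      have := hne i j
      have := hne i k
      field_simp
      ring
    exact (mul_eq_zero.1 h).resolve_left hsub
  have hGpos : ∀ j, 0 < G j j := fun j =>
    Finset.sum_pos (fun i _ => by
      rw [mul_assoc]
      exact mul_pos (hw i) (mul_self_pos.2 (inv_ne_zero (hne i j)))) Finset.univ_nonempty
  have hGmu : ∀ j k, ∑ i, mu i * (w i * (mu i - lam j)⁻¹ * (mu i - lam k)⁻¹) = lam j * G j k := by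
    intro j k
    rw [← add_zero (lam j * G j k), ← hsum k, hG, Finset.mul_sum, ← Finset.sum_add_distrib]
    refine Finset.sum_congr rfl fun i _ => ?_
    have := hne i j
    have := hne i k
    field_simp
    ring
  have hsq : ∀ i, √(w i) * √(w i) = w i := fun i => Real.mul_self_sqrt (hw i).le
  have hnorm : ∀ j, (√(G j j))⁻¹ * (√(G j j))⁻¹ * G j j = 1 := by
    intro j
    rw [← mul_inv, Real.mul_self_sqrt (hGpos j).le, inv_mul_cancel₀ (hGpos j).ne']
  refine ⟨Matrix.of fun i j => √(w i) * (mu i - lam j)⁻¹ * (√(G j j))⁻¹, ?_, ?_⟩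
  · ext j k
    have h : ∑ i, √(w i) * (mu i - lam j)⁻¹ * (√(G j j))⁻¹ *
        (√(w i) * (mu i - lam k)⁻¹ * (√(G k k))⁻¹) = (√(G j j))⁻¹ * (√(G k k))⁻¹ * G j k := by
      rw [hG, Finset.mul_sum]
      refine Finset.sum_congr rfl fun i _ => ?_
      nth_rewrite 3 [← hsq i]
      ring
    simp only [mul_apply, transpose_apply, of_apply]
    rw [h]
    rcases eq_or_ne j k with rfl | hjk
    · rw [hnorm, one_apply_eq]
    · rw [hGoff j k hjk, mul_zero, one_apply_ne hjk]
  · ext j k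
    have h : ∑ i, √(w i) * (mu i - lam j)⁻¹ * (√(G j j))⁻¹ * mu i *
        (√(w i) * (mu i - lam k)⁻¹ * (√(G k k))⁻¹) =
        (√(G j j))⁻¹ * (√(G k k))⁻¹ * (lam j * G j k) := by
      rw [← hGmu, Finset.mul_sum]
      refine Finset.sum_congr rfl fun i _ => ?_
      nth_rewrite 3 [← hsq i]
      ring
    rw [mul_apply]
    simp only [mul_diagonal, transpose_apply, of_apply]
    rw [h]
    rcases eq_or_ne j k with rfl | hjk
    · rw [diagonal_apply_eq, mul_left_comm, hnorm, mul_one]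
    · rw [hGoff j k hjk, mul_zero, mul_zero, diagonal_apply_ne _ hjk]

/-- The matrices with orthonormal columns form a compact set. -/
lemma isCompact_setOf_transpose_mul_self_eq_one (m n : ℕ) :
    IsCompact {W : Matrix (Fin m) (Fin n) ℝ | Wᵀ * W = 1} := by
  have hbox : IsCompact (Set.univ.pi fun _ : Fin m => Set.univ.pi fun _ : Fin n =>
      Set.Icc (-1 : ℝ) 1) :=
    isCompact_univ_pi fun _ => isCompact_univ_pi fun _ => isCompact_Icc
  refine hbox.of_isClosed_subset
    (isClosed_eq (by fun_prop) continuous_const) fun W hW i _ j _ => ?_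
  have h : ∑ l, W l j * W l j = 1 := by
    exact (congrFun (congrFun hW j) j).trans (one_apply_eq j)
  have hle : W i j * W i j ≤ 1 :=
    h ▸ Finset.single_le_sum (f := fun l => W l j * W l j)
      (fun l _ => mul_self_nonneg _) (Finset.mem_univ i)
  exact abs_le.1 (abs_le_one_iff_mul_self_le_one.2 hle)

open Filter Topology in
/-- Converse of Cauchy interlacing in codimension one. -/
lemma exists_isometry_diagonal_of_interlace_succ {n : ℕ} (mu : Fin (n + 1) → ℝ)
    (lam : Fin n → ℝ) (h₁ : ∀ j, mu j.castSucc ≤ lam j) (h₂ : ∀ j, lam j ≤ mu j.succ) :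
    ∃ W : Matrix (Fin (n + 1)) (Fin n) ℝ,
      Wᵀ * W = 1 ∧ Wᵀ * diagonal mu * W = diagonal lam := by
  let mu' : ℝ → Fin (n + 1) → ℝ := fun t i => mu i + 2 * (i : ℕ) * t
  let lam' : ℝ → Fin n → ℝ := fun t j => lam j + (2 * (j : ℕ) + 1) * t
  let t : ℕ → ℝ := fun k => 1 / ((k : ℝ) + 1)
  have ht : ∀ k, 0 < t k := fun k => Nat.one_div_pos_of_nat
  have hex : ∀ k, ∃ W : Matrix (Fin (n + 1)) (Fin n) ℝ,
      Wᵀ * W = 1 ∧ Wᵀ * diagonal (mu' (t k)) * W = diagonal (lam' (t k)) := by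
    refine fun k => exists_isometry_diagonal_of_strict_interlace _ _ (fun j => ?_) fun j => ?_
    · simp only [mu', lam', Fin.val_castSucc]
      linarith [h₁ j, ht k]
    · simp only [mu', lam', Fin.val_succ]
      push_cast
      linarith [h₂ j, ht k]
  choose W hW₁ hW₂ using hex
  have : FirstCountableTopology (Matrix (Fin (n + 1)) (Fin n) ℝ) :=
    inferInstanceAs (FirstCountableTopology (Fin (n + 1) → Fin n → ℝ))
  obtain ⟨W₀, hW₀, φ, hφ, hlim⟩ :=
    (isCompact_setOf_transpose_mul_self_eq_one (n + 1) n).tendsto_subseq hW₁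
  refine ⟨W₀, hW₀, ?_⟩
  have htlim : Tendsto (t ∘ φ) atTop (𝓝 0) :=
    tendsto_one_div_add_atTop_nhds_zero_nat.comp hφ.tendsto_atTop
  have hpair := hlim.prodMk_nhds htlim
  have hL : Continuous fun p : Matrix (Fin (n + 1)) (Fin n) ℝ × ℝ =>
      p.1ᵀ * diagonal (mu' p.2) * p.1 := by fun_prop
  have hR : Continuous fun p : Matrix (Fin (n + 1)) (Fin n) ℝ × ℝ =>
      diagonal (lam' p.2) := by fun_prop
  have hl := (hL.tendsto _).comp hpair
  have hr := (hR.tendsto _).comp hpair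
  have heq := tendsto_nhds_unique hl (hr.congr fun k => (hW₂ (φ k)).symm)
  simpa [mu', lam'] using heq

/-- Converse of Cauchy interlacing (Fan–Pall): if `lam` interlaces `mu`, then
`diagonal lam` is an isometric compression of `diagonal mu`. -/
lemma exists_isometry_diagonal_of_interlace {n : ℕ} (k : ℕ) (mu : Fin (n + k) → ℝ)
    (lam : Fin n → ℝ) (hmu : Monotone mu) (hlam : Monotone lam)
    (h₁ : ∀ i : Fin n, mu ⟨i, by omega⟩ ≤ lam i)
    (h₂ : ∀ i : Fin n, lam i ≤ mu ⟨i + k, by omega⟩) :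
    ∃ W : Matrix (Fin (n + k)) (Fin n) ℝ,
      Wᵀ * W = 1 ∧ Wᵀ * diagonal mu * W = diagonal lam := by
  induction k with
  | zero =>
    refine ⟨1, by simp, ?_⟩
    have : mu = lam := funext fun i => le_antisymm (h₁ i) (h₂ i)
    simp [this]
  | succ k ih =>
    let nu : Fin (n + k) → ℝ := fun i =>
      if h : k ≤ i then max (mu ⟨i, by omega⟩) (lam ⟨i - k, by omega⟩) else mu ⟨i, by omega⟩
    have hnu : ∀ i : Fin (n + k), mu ⟨i, by omega⟩ ≤ nu i := by
      intro i
      simp only [nu]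
      split_ifs
      exacts [le_max_left _ _, le_rfl]
    have hnu' : Monotone nu := by
      intro i j hij
      have hij' : (i : ℕ) ≤ j := hij
      have hmij : mu ⟨i, by omega⟩ ≤ mu ⟨j, by omega⟩ := hmu hij'
      by_cases hi : k ≤ i
      · have hj : k ≤ j := hi.trans hij'
        simp only [nu, hi, hj, dite_true]
        exact max_le_max hmij (hlam (Nat.sub_le_sub_right hij' k))
      · refine le_trans ?_ (hnu j)
        simpa only [nu, hi, dite_false] using hmij
    obtain ⟨W₁, hW₁, hW₁'⟩ := exists_isometry_diagonal_of_interlace_succ (n := n + k) mu nu hnu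
      (fun i => by
        have hsucc : mu ⟨i, by omega⟩ ≤ mu i.succ := hmu (Nat.le_succ i)
        simp only [nu]
        split_ifs with hi
        · refine max_le hsucc ((h₂ _).trans (hmu ?_))
          rw [Fin.le_def]
          simp only [Fin.val_succ]
          omega
        · exact hsucc)
    obtain ⟨W₂, hW₂, hW₂'⟩ := ih nu hnu'
      (fun i => by
        simp only [nu]
        split_ifs with hi
        · exact max_le (h₁ i) (hlam (Nat.sub_le _ _))
        · exact h₁ i)
      (fun i => by
        have hi : k ≤ (i : ℕ) + k := Nat.le_add_left _ _
        simp only [nu, hi, dite_true, Nat.add_sub_cancel]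
        exact le_max_right _ _)
    refine ⟨W₁ * W₂, ?_, ?_⟩
    · rw [transpose_mul, Matrix.mul_assoc, ← Matrix.mul_assoc W₁ᵀ, hW₁, Matrix.one_mul, hW₂]
    · rw [transpose_mul, ← hW₂', ← hW₁']
      simp only [Matrix.mul_assoc]

/-- A dimension count: some nonzero vector supported on `p` has image vanishing on `q`. -/
lemma exists_ne_zero_support_mulVec_eq_zero {m n : Type*} [Fintype n]
    (W : Matrix m n ℝ) (p : Finset n) (q : Finset m) (h : q.card < p.card) :
    ∃ y : n → ℝ, y ≠ 0 ∧ (∀ i ∉ p, y i = 0) ∧ ∀ i ∈ q, (W *ᵥ y) i = 0 := by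
  classical
  let M : Matrix q p ℝ := W.submatrix (↑) (↑)
  have hker : LinearMap.ker M.mulVecLin ≠ ⊥ :=
    LinearMap.ker_ne_bot_of_finrank_lt (by simpa using h)
  obtain ⟨x, hx, hx0⟩ := Submodule.exists_mem_ne_zero_of_ne_bot hker
  refine ⟨fun i => if hi : i ∈ p then x ⟨i, hi⟩ else 0, ?_, fun i hi => by simp [hi], ?_⟩
  · intro h0
    refine hx0 (funext fun i => ?_)
    have := congrFun h0 i
    simpa using this
  · intro i hi
    have hxi : ∑ j : p, W i j * x j = 0 := congrFun (LinearMap.mem_ker.1 hx) ⟨i, hi⟩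
    refine Eq.trans ?_ hxi
    rw [mulVec, dotProduct, ← Finset.sum_subset (Finset.subset_univ p)
      (fun j _ hj => by simp [hj]), ← Finset.sum_coe_sort p]
    exact Finset.sum_congr rfl fun j _ => by simp

lemma dotProduct_diagonal_mulVec_eq_of_isometry {m n : Type*} [Fintype m] [Fintype n]
    [DecidableEq m] [DecidableEq n] {mu : m → ℝ} {lam : n → ℝ} {W : Matrix m n ℝ}
    (hW' : Wᵀ * diagonal mu * W = diagonal lam) (y : n → ℝ) :
    ∑ i, mu i * ((W *ᵥ y) i * (W *ᵥ y) i) = ∑ j, lam j * (y j * y j) := by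
  have h : (W *ᵥ y) ⬝ᵥ (diagonal mu *ᵥ (W *ᵥ y)) = y ⬝ᵥ (diagonal lam *ᵥ y) := by
    rw [← hW', ← mulVec_mulVec, ← mulVec_mulVec, dotProduct_mulVec y, vecMul_transpose]
  simp only [dotProduct, mulVec_diagonal] at h
  convert h using 2 <;> ring

/-- Comparison of Rayleigh quotients: `c ≤ mu` off `q` and `lam ≤ d` on `p` force `c ≤ d`. -/
lemma le_of_isometry_diagonal {m n : Type*} [Fintype m] [Fintype n]
    [DecidableEq m] [DecidableEq n] {mu : m → ℝ} {lam : n → ℝ} {W : Matrix m n ℝ}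
    (hW : Wᵀ * W = 1) (hW' : Wᵀ * diagonal mu * W = diagonal lam)
    (p : Finset n) (q : Finset m) (h : q.card < p.card) {c d : ℝ}
    (hc : ∀ i ∉ q, c ≤ mu i) (hd : ∀ j ∈ p, lam j ≤ d) : c ≤ d := by
  obtain ⟨y, hy, hyp, hyq⟩ := exists_ne_zero_support_mulVec_eq_zero W p q h
  have hnorm : ∑ i, 1 * ((W *ᵥ y) i * (W *ᵥ y) i) = ∑ j, 1 * (y j * y j) :=
    dotProduct_diagonal_mulVec_eq_of_isometry (mu := fun _ => 1) (lam := fun _ => 1)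
      (by simpa using hW) y
  have hquad := dotProduct_diagonal_mulVec_eq_of_isometry hW' y
  have hpos : 0 < ∑ j, 1 * (y j * y j) := by
    obtain ⟨j, hj⟩ := Function.ne_iff.1 hy
    refine Finset.sum_pos' (fun j _ => by nlinarith [mul_self_nonneg (y j)])
      ⟨j, Finset.mem_univ j, ?_⟩
    rw [one_mul]
    exact mul_self_pos.2 hj
  have hlow : c * ∑ i, 1 * ((W *ᵥ y) i * (W *ᵥ y) i) ≤
      ∑ i, mu i * ((W *ᵥ y) i * (W *ᵥ y) i) := by
    rw [Finset.mul_sum]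
    refine Finset.sum_le_sum fun i _ => ?_
    by_cases hi : i ∈ q
    · simp [hyq i hi]
    · rw [one_mul]
      exact mul_le_mul_of_nonneg_right (hc i hi) (mul_self_nonneg _)
  have hupp : ∑ j, lam j * (y j * y j) ≤ d * ∑ j, 1 * (y j * y j) := by
    rw [Finset.mul_sum]
    refine Finset.sum_le_sum fun j _ => ?_
    by_cases hj : j ∈ p
    · rw [one_mul]
      exact mul_le_mul_of_nonneg_right (hd j hj) (mul_self_nonneg _)
    · simp [hyp j hj]
  rw [hnorm, hquad] at hlow
  exact le_of_mul_le_mul_right (hlow.trans hupp) hpos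

/-- Cauchy interlacing for isometric compressions of diagonal matrices. -/
lemma interlace_of_isometry_diagonal {n k : ℕ} {mu : Fin (n + k) → ℝ} {lam : Fin n → ℝ}
    (hmu : Monotone mu) (hlam : Monotone lam) {W : Matrix (Fin (n + k)) (Fin n) ℝ}
    (hW : Wᵀ * W = 1) (hW' : Wᵀ * diagonal mu * W = diagonal lam) (i : Fin n) :
    mu ⟨i, by omega⟩ ≤ lam i ∧ lam i ≤ mu ⟨i + k, by omega⟩ := by
  constructor
  · refine le_of_isometry_diagonal hW hW' (Finset.Iic i) (Finset.Iio ⟨i, by omega⟩)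
      (by simp) (fun l hl => hmu (not_lt.1 fun h => hl (Finset.mem_Iio.2 h)))
      fun j hj => hlam (Finset.mem_Iic.1 hj)
  · have hneg : Wᵀ * diagonal (-mu) * W = diagonal (-lam) := by
      have h₁ : diagonal (-mu) = -diagonal mu := (diagonal_neg mu).symm
      have h₂ : diagonal (-lam) = -diagonal lam := (diagonal_neg lam).symm
      rw [h₁, h₂, Matrix.mul_neg, Matrix.neg_mul, hW']
    refine neg_le_neg_iff.1 <| le_of_isometry_diagonal hW hneg (Finset.Ici i)
      (Finset.Ioi ⟨i + k, by omega⟩) (by simp; omega)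
      (fun l hl => neg_le_neg (hmu (not_lt.1 fun h => hl (Finset.mem_Ioi.2 h))))
      fun j hj => neg_le_neg (hlam (Finset.mem_Ici.1 hj))

/-- RBS exactness for a two-term affine family: a sparse reduced basis `Z` reproducing
`Vᵀ (a A₁ + b A₂) V` for all scalars `a, b` exists iff the generalized eigenvalues of the
reduced pencil interlace those of the sampled pencil. -/
theorem stmt0 {N n m : ℕ} (hnm : n ≤ m) (hmN : m ≤ N)
    (A₁ A₂ : Matrix (Fin N) (Fin N) ℝ) (hA₁ : A₁.PosDef) (hA₂ : A₂.PosDef)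
    (V : Matrix (Fin N) (Fin n) ℝ) (hV : V.rank = n)
    (ι : Fin m → Fin N) (hι : Function.Injective ι)
    (S : Matrix (Fin N) (Fin m) ℝ) (hS : S = samplingMatrix ι)
    (lamr : Fin n → ℝ) (lams : Fin m → ℝ)
    (hr : IsSortedGenEigs (Vᵀ * A₂ * V) (Vᵀ * A₁ * V) lamr)
    (hs : IsSortedGenEigs (Sᵀ * A₂ * S) (Sᵀ * A₁ * S) lams) :
    (∃ Z : Matrix (Fin m) (Fin n) ℝ,
        ∀ a b : ℝ, Zᵀ * (Sᵀ * (a • A₁ + b • A₂) * S) * Z = Vᵀ * (a • A₁ + b • A₂) * V)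
      ↔ ∀ i : Fin n,
          lams ⟨i.1, by have := i.2; omega⟩ ≤ lamr i ∧
          lamr i ≤ lams ⟨i.1 + (m - n), by have := i.2; omega⟩ := by
  obtain ⟨hrmono, R, hR₁, hR₂⟩ := hr
  obtain ⟨hsmono, T, hT₁, hT₂⟩ := hs
  obtain ⟨k, rfl⟩ := Nat.exists_eq_add_of_le hnm
  have hR : R * (Rᵀ * (Vᵀ * A₁ * V)) = 1 := mul_eq_one_comm.1 hR₁
  have hT : T * (Tᵀ * (Sᵀ * A₁ * S)) = 1 := mul_eq_one_comm.1 hT₁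
  generalize Rᵀ * (Vᵀ * A₁ * V) = R' at hR
  generalize Tᵀ * (Sᵀ * A₁ * S) = T' at hT
  have hR' : R'ᵀ * Rᵀ = 1 := by rw [← transpose_mul, hR, transpose_one]
  have hT' : T'ᵀ * Tᵀ = 1 := by rw [← transpose_mul, hT, transpose_one]
  constructor
  · rintro ⟨Z, hZ⟩
    have hZ₁ : Zᵀ * (Sᵀ * A₁ * S) * Z = Vᵀ * A₁ * V := by simpa using hZ 1 0
    have hZ₂ : Zᵀ * (Sᵀ * A₂ * S) * Z = Vᵀ * A₂ * V := by simpa using hZ 0 1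
    have hcongr : ∀ B : Matrix (Fin (n + k)) (Fin (n + k)) ℝ,
        (T' * Z * R)ᵀ * (Tᵀ * B * T) * (T' * Z * R) = Rᵀ * (Zᵀ * B * Z) * R := by
      intro B
      calc (T' * Z * R)ᵀ * (Tᵀ * B * T) * (T' * Z * R)
          = Rᵀ * (Zᵀ * ((T'ᵀ * Tᵀ) * B * (T * T')) * Z) * R := by
            simp only [transpose_mul, Matrix.mul_assoc]
        _ = _ := by rw [hT, hT', Matrix.one_mul, Matrix.mul_one]
    have hW₁ := hcongr (Sᵀ * A₁ * S)
    have hW₂ := hcongr (Sᵀ * A₂ * S)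
    rw [hT₁, Matrix.mul_one, hZ₁, hR₁] at hW₁
    rw [hT₂, hZ₂, hR₂] at hW₂
    simpa only [Nat.add_sub_cancel_left] using
      interlace_of_isometry_diagonal hsmono hrmono hW₁ hW₂
  · intro h
    simp only [Nat.add_sub_cancel_left] at h
    obtain ⟨W, hW₁, hW₂⟩ := exists_isometry_diagonal_of_interlace k lams lamr hsmono hrmono
      (fun i => (h i).1) fun i => (h i).2
    have hcongr : ∀ B : Matrix (Fin (n + k)) (Fin (n + k)) ℝ,
        (T * W * R')ᵀ * B * (T * W * R') = R'ᵀ * (Wᵀ * (Tᵀ * B * T) * W) * R' := by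
      intro B
      simp only [transpose_mul, Matrix.mul_assoc]
    have hcancel : ∀ C : Matrix (Fin n) (Fin n) ℝ, R'ᵀ * (Rᵀ * C * R) * R' = C := by
      intro C
      calc R'ᵀ * (Rᵀ * C * R) * R' = (R'ᵀ * Rᵀ) * C * (R * R') := by
            simp only [Matrix.mul_assoc]
        _ = C := by rw [hR, hR', Matrix.one_mul, Matrix.mul_one]
    have hZ₁ := hcongr (Sᵀ * A₁ * S)
    have hZ₂ := hcongr (Sᵀ * A₂ * S)
    rw [hT₁, Matrix.mul_one, hW₁, ← hR₁, hcancel] at hZ₁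
    rw [hT₂, hW₂, ← hR₂, hcancel] at hZ₂
    refine ⟨T * W * R', fun a b => ?_⟩
    have hS' : Sᵀ * (a • A₁ + b • A₂) * S = a • (Sᵀ * A₁ * S) + b • (Sᵀ * A₂ * S) := by
      simp [Matrix.mul_add, Matrix.add_mul]
    have hV' : Vᵀ * (a • A₁ + b • A₂) * V = a • (Vᵀ * A₁ * V) + b • (Vᵀ * A₂ * V) := by
      simp [Matrix.mul_add, Matrix.add_mul]
    rw [hS', hV', ← hZ₁, ← hZ₂, Matrix.mul_add, Matrix.add_mul, Matrix.mul_smul, Matrix.mul_smul,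
      Matrix.smul_mul, Matrix.smul_mul]
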